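/- arXiv:2312.08710 — 3 statements merged into one kernel-verified Lean document; each statement's English description precedes it below -/
import Mathlib

section
/- Let A : ℝⁿ → ℝ be continuously differentiable with gradient ∇A, and let π : ℝⁿ → ℝ be a continuous nonnegative function with compact support. Define F : ℝ → ℝ by F(α) = ∫_{ℝⁿ} π(a)·A(a + α·∇A(a)) da. Then F is differentiable at α = 0 with F′(0) = ∫_{ℝⁿ} π(a)·‖∇A(a)‖² da. -/
open MeasureTheory

theorem ContDiff.continuous_gradient {E : Type*} [NormedAddCommGroup E] [InnerProductSpace ℝ E]
    [CompleteSpace E] {f : E → ℝ} (hf : ContDiff ℝ 1 f) : Continuous (gradient f) :=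
  (InnerProductSpace.toDual ℝ E).symm.continuous.comp (hf.continuous_fderiv one_ne_zero)

/-- Single-state differentiated form of Proposition 1: the estimated expected
advantage `F(α) = ∫ π(a) A(a + α ∇A(a)) da` has derivative
`∫ π(a) ‖∇A(a)‖² da` at `α = 0`. -/
theorem hasDerivAt_expected_advantage {n : ℕ}
    (A : EuclideanSpace ℝ (Fin n) → ℝ) (hA : ContDiff ℝ 1 A)
    (π : EuclideanSpace ℝ (Fin n) → ℝ)
    (hπc : Continuous π) (hπ0 : ∀ a, 0 ≤ π a) (hπsupp : HasCompactSupport π) :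
    HasDerivAt (fun α : ℝ => ∫ a, π a * A (a + α • gradient A a))
      (∫ a, π a * ‖gradient A a‖ ^ 2) 0 := by
  have hg : Continuous (gradient A) := hA.continuous_gradient
  have hAc : Continuous A := hA.continuous
  let D : ℝ → EuclideanSpace ℝ (Fin n) → ℝ := fun α a =>
    inner ℝ (gradient A (a + α • gradient A a)) (gradient A a)
  have hD : Continuous (fun p : ℝ × EuclideanSpace ℝ (Fin n) => D p.1 p.2) := by
    fun_prop
  obtain ⟨C, hC⟩ := ((isCompact_Icc (a := (-1 : ℝ)) (b := 1)).prod
    hπsupp.isCompact).exists_bound_of_continuousOn hD.continuousOn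
  have hF : ∀ α : ℝ, Continuous fun a => π a * A (a + α • gradient A a) := fun α => by
    fun_prop
  have hderiv : ∀ (a : EuclideanSpace ℝ (Fin n)) (α : ℝ),
      HasDerivAt (fun t : ℝ => π a * A (a + t • gradient A a)) (π a * D α a) α := by
    intro a α
    have h := (hA.differentiable one_ne_zero
      (a + α • gradient A a)).hasGradientAt.hasFDerivAt.comp_hasDerivAt α
      (((hasDerivAt_id α).smul_const (gradient A a)).const_add a)
    rw [one_smul, InnerProductSpace.toDual_apply_apply] at h
    exact h.const_mul (π a)
  have key := hasDerivAt_integral_of_dominated_loc_of_deriv_le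
    (μ := (volume : Measure (EuclideanSpace ℝ (Fin n))))
    (F := fun (α : ℝ) a => π a * A (a + α • gradient A a))
    (F' := fun α a => π a * D α a) (bound := fun a => π a * C)
    (Icc_mem_nhds (by norm_num : (-1 : ℝ) < 0) one_pos)
    (.of_forall fun α => (hF α).aestronglyMeasurable)
    ((hF 0).integrable_of_hasCompactSupport hπsupp.mul_right)
    (hπc.mul (hD.comp (by fun_prop : Continuous fun a => ((0 : ℝ), a)))).aestronglyMeasurable
    (.of_forall fun a α hα => by
      by_cases ha : a ∈ tsupport π
      · rw [norm_mul, Real.norm_of_nonneg (hπ0 a)]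
        exact mul_le_mul_of_nonneg_left (hC (α, a) ⟨hα, ha⟩) (hπ0 a)
      · simp [image_eq_zero_of_notMem_tsupport ha])
    ((hπc.integrable_of_hasCompactSupport hπsupp).mul_const C)
    (.of_forall fun a α _ => hderiv a α)
  simpa only [D, zero_smul, add_zero, real_inner_self_eq_norm_sq] using key.2
end

section
/- Let A : ℝⁿ → ℝ be twice continuously differentiable with gradient ∇A and Hessian ∇²A(a), let α ∈ ℝ satisfy det(I + α·∇²A(a)) > 0 for every a ∈ ℝⁿ, and let g : ℝⁿ → ℝⁿ be continuously differentiable with det(Dg(ε)) ≠ 0 for every ε. Let q, π, π_α : ℝⁿ → ℝ be functions such that π(g(ε)) = q(ε)·|det(Dg(ε))|⁻¹ for every ε, and π_α(a + α·∇A(a)) = π(a) / det(I + α·∇²A(a)) for every a. Define g_α(ε) = g(ε) + α·∇A(g(ε)). Then for every ε ∈ ℝⁿ, g_α is differentiable at ε with det(Dg_α(ε)) ≠ 0, and π_α(g_α(ε)) = q(ε)·|det(Dg_α(ε))|⁻¹. -/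
/-- The gradient of a twice continuously differentiable function is differentiable. -/
theorem ContDiff.differentiable_gradient {F : Type*} [NormedAddCommGroup F]
    [InnerProductSpace ℝ F] [CompleteSpace F] {f : F → ℝ} (hf : ContDiff ℝ 2 f) :
    Differentiable ℝ (gradient f) :=
  (InnerProductSpace.toDual ℝ F).symm.differentiable.comp
    ((hf.fderiv_right (m := 1) (by norm_num)).differentiable (by norm_num))

/-- The determinant of continuous linear endomorphisms is multiplicative. -/
theorem ContinuousLinearMap.det_comp {F : Type*} [NormedAddCommGroup F] [NormedSpace ℝ F]
    (L M : F →L[ℝ] F) : (L.comp M).det = L.det * M.det :=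
  LinearMap.det_comp _ _

/-- Proposition 2: if `π ≜ g` (density formula `π(g ε) = q(ε) |det Dg(ε)|⁻¹`)
and `π_α` is the α-policy, then `π_α ≜ g_α` where `g_α(ε) = g(ε) + α ∇A(g(ε))`:
`g_α` is differentiable with nonzero Jacobian determinant and
`π_α(g_α ε) = q(ε) |det Dg_α(ε)|⁻¹`. -/
theorem alpha_policy_reparameterization {n : ℕ}
    (A : EuclideanSpace ℝ (Fin n) → ℝ) (hA : ContDiff ℝ 2 A) (α : ℝ)
    (hdet : ∀ a, 0 < (ContinuousLinearMap.id ℝ (EuclideanSpace ℝ (Fin n)) +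
      α • fderiv ℝ (gradient A) a).det)
    (g : EuclideanSpace ℝ (Fin n) → EuclideanSpace ℝ (Fin n))
    (hg : ContDiff ℝ 1 g) (hgdet : ∀ ε, (fderiv ℝ g ε).det ≠ 0)
    (q π πα : EuclideanSpace ℝ (Fin n) → ℝ)
    (hπ : ∀ ε, π (g ε) = q ε * |(fderiv ℝ g ε).det|⁻¹)
    (hπα : ∀ a, πα (a + α • gradient A a) =
      π a / (ContinuousLinearMap.id ℝ (EuclideanSpace ℝ (Fin n)) +
        α • fderiv ℝ (gradient A) a).det)
    (gα : EuclideanSpace ℝ (Fin n) → EuclideanSpace ℝ (Fin n))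
    (hgα : gα = fun ε => g ε + α • gradient A (g ε)) :
    ∀ ε, DifferentiableAt ℝ gα ε ∧ (fderiv ℝ gα ε).det ≠ 0 ∧
      πα (gα ε) = q ε * |(fderiv ℝ gα ε).det|⁻¹ := by
  subst hgα
  intro ε
  have hg' : HasFDerivAt g (fderiv ℝ g ε) ε :=
    (hg.differentiable (by norm_num) ε).hasFDerivAt
  have hgrad := (hA.differentiable_gradient (g ε)).hasFDerivAt
  have hgα : HasFDerivAt (fun ε => g ε + α • gradient A (g ε))
      ((ContinuousLinearMap.id ℝ (EuclideanSpace ℝ (Fin n)) +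
        α • fderiv ℝ (gradient A) (g ε)).comp (fderiv ℝ g ε)) ε :=
    ((hasFDerivAt_id (g ε)).add (hgrad.const_smul α)).comp ε hg'
  have hpos := hdet (g ε)
  refine ⟨hgα.differentiableAt, ?_, ?_⟩
  · rw [hgα.fderiv, ContinuousLinearMap.det_comp]
    exact mul_ne_zero hpos.ne' (hgdet ε)
  · rw [hgα.fderiv, ContinuousLinearMap.det_comp, hπα, hπ, abs_mul, abs_of_pos hpos, mul_inv,
      div_eq_mul_inv]
    ring
end

section
/- Let n, T ∈ ℕ, let c be a nonzero real number, and let δ₀, δ₁, …, δ_T : ℝⁿ → ℝ be functions each differentiable at a point a ∈ ℝⁿ. Fix t with 0 ≤ t ≤ T and suppose the Fréchet derivative D δ_k(a) = 0 for every k < t. Define A_t(x) = Σ_{k=0}^{T−t} c^k · δ_{t+k}(x) and A_0(x) = Σ_{k=0}^{T} c^k · δ_k(x). Then A_t and A_0 are differentiable at a, and D A_t(a) = c^{−t} · D A_0(a). -/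
theorem hasFDerivAt_sum_pow_mul {E : Type*} [NormedAddCommGroup E] [NormedSpace ℝ E] (c : ℝ)
    {f : ℕ → E → ℝ} {a : E} {N : ℕ} (hf : ∀ k < N, DifferentiableAt ℝ (f k) a) :
    HasFDerivAt (fun x => ∑ k ∈ Finset.range N, c ^ k * f k x)
      (∑ k ∈ Finset.range N, c ^ k • fderiv ℝ (f k) a) a :=
  HasFDerivAt.fun_sum fun k hk =>
    (hf k (Finset.mem_range.mp hk)).hasFDerivAt.const_mul (c ^ k)

/-- GAE gradient identity (Appendix B.1, Equation 14):
`D A_t(a) = c⁻ᵗ • D A_0(a)` when the TD residuals `δ_k` with `k < t` have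
vanishing derivative at `a`. -/
theorem gae_gradient_identity {n T : ℕ} (c : ℝ) (hc : c ≠ 0)
    (δ : ℕ → EuclideanSpace ℝ (Fin n) → ℝ)
    (a : EuclideanSpace ℝ (Fin n))
    (hδ : ∀ k ≤ T, DifferentiableAt ℝ (δ k) a)
    (t : ℕ) (ht : t ≤ T)
    (hzero : ∀ k < t, fderiv ℝ (δ k) a = 0) :
    DifferentiableAt ℝ (fun x => ∑ k ∈ Finset.range (T - t + 1), c ^ k * δ (t + k) x) a ∧
    DifferentiableAt ℝ (fun x => ∑ k ∈ Finset.range (T + 1), c ^ k * δ k x) a ∧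
    fderiv ℝ (fun x => ∑ k ∈ Finset.range (T - t + 1), c ^ k * δ (t + k) x) a =
      c ^ (-(t : ℤ)) • fderiv ℝ (fun x => ∑ k ∈ Finset.range (T + 1), c ^ k * δ k x) a := by
  have hA := hasFDerivAt_sum_pow_mul c (f := fun k => δ (t + k)) (a := a) (N := T - t + 1)
    fun k hk => hδ (t + k) (by omega)
  have hA₀ := hasFDerivAt_sum_pow_mul c (f := δ) (a := a) (N := T + 1)
    fun k hk => hδ k (by omega)
  refine ⟨hA.differentiableAt, hA₀.differentiableAt, ?_⟩
  have hvanish : ∑ k ∈ Finset.range t, c ^ k • fderiv ℝ (δ k) a = 0 :=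
    Finset.sum_eq_zero fun k hk => by rw [hzero k (Finset.mem_range.mp hk), smul_zero]
  rw [hA.fderiv, hA₀.fderiv, show T + 1 = t + (T - t + 1) by omega, Finset.sum_range_add _ t,
    hvanish, zero_add, Finset.smul_sum]
  refine Finset.sum_congr rfl fun k _ => ?_
  rw [smul_smul, pow_add, zpow_neg, zpow_natCast, inv_mul_cancel_left₀ (pow_ne_zero t hc)]
end
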